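/- Let (K, ≼, Φ) be the marked cascade poset of a finite-dimensional complex simple Lie algebra g. Then: (1) the partial order on K (in which β₁ = θ is the unique maximal element and each β_i covers exactly its descendants) coincides with the restriction to K of the root order ≼ on Δ⁺; (2) two elements β_i, β_j ∈ K are comparable if and only if supp(β_i) ∩ supp(β_j) ≠ ∅, and in that case one support is properly contained in the other; (3) each β_j with j ≥ 2 is covered by a unique element of K; (4) for any β_j ∈ K, the interval [β_j, β₁]_K = {ν ∈ K : β_j ≼ ν ≼ β₁} is a chain; (5) for α ∈ Π, one has α ∈ Φ(β_i) if and only if (α, β_i) > 0. -/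

import Mathlib

open scoped RealInnerProductSpace

attribute [local instance] Classical.propDecidable

section RootCombinatorics

variable {V : Type*} [NormedAddCommGroup V] [InnerProductSpace ℝ V]

/-- The Cartan pairing `⟨γ, α∨⟩ = 2 (γ, α) / (α, α)`. -/
noncomputable def cartanPairing (γ α : V) : ℝ := 2 * ⟪γ, α⟫ / ⟪α, α⟫

/-- The coroot `γ∨ = 2 γ / (γ, γ)`. -/
noncomputable def covec (γ : V) : V := (2 / ⟪γ, γ⟫) • γ

/-- The cascade element `x_K = Σ_{β ∈ K} β / (β, β) = ½ Σ_{β ∈ K} β∨`. -/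
noncomputable def cascElt (K : Finset V) : V := ∑ β ∈ K, (⟪β, β⟫)⁻¹ • β

/-- The roots of `S` orthogonal to `β`. -/
noncomputable def orthSub (S : Finset V) (β : V) : Finset V := S.filter fun γ => ⟪γ, β⟫ = 0

/-- One step of the non-orthogonality (connectedness) relation inside `S`. -/
def connRel (S : Finset V) (a b : V) : Prop := a ∈ S ∧ b ∈ S ∧ ⟪a, b⟫ ≠ 0

/-- The irreducible component of the root subsystem `S` containing `γ`. -/
noncomputable def component (S : Finset V) (γ : V) : Finset V :=
  S.filter fun γ' => Relation.ReflTransGen (connRel S) γ γ'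

/-- `C` is an irreducible component of the root subsystem `S`. -/
def IsComponent (S C : Finset V) : Prop := ∃ γ ∈ S, C = component S γ

end RootCombinatorics

/-- The combinatorial data of an irreducible crystallographic root system with a chosen
system of positive roots, base (set of simple roots) and highest root: the combinatorial
skeleton of a finite-dimensional complex simple Lie algebra, with the Killing-form
identification of the Cartan subalgebra and its dual. -/
structure RootSystemCtx (V : Type*) [NormedAddCommGroup V] [InnerProductSpace ℝ V] where
  /-- the set of roots Δ -/
  Δ : Finset V
  /-- the set of simple roots Π -/
  base : Finset V
  /-- the set of positive roots Δ⁺ -/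
  Pos : Finset V
  /-- the highest root θ -/
  θ : V
  zero_not_mem : (0 : V) ∉ Δ
  neg_mem : ∀ γ ∈ Δ, -γ ∈ Δ
  reflect_mem : ∀ α ∈ Δ, ∀ γ ∈ Δ, γ - cartanPairing γ α • α ∈ Δ
  pairing_int : ∀ α ∈ Δ, ∀ γ ∈ Δ, ∃ k : ℤ, cartanPairing γ α = (k : ℝ)
  span_eq : Submodule.span ℝ (Δ : Set V) = ⊤
  base_subset : base ⊆ Pos
  base_indep : LinearIndependent ℝ (fun a : {x // x ∈ base} => (a : V))
  pos_subset : Pos ⊆ Δ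
  pos_or_neg : ∀ γ ∈ Δ, γ ∈ Pos ∨ -γ ∈ Pos
  pos_not_neg : ∀ γ ∈ Pos, -γ ∉ Pos
  pos_coords : ∀ γ ∈ Pos, γ ∈ AddSubmonoid.closure (base : Set V)
  irreducible : ∀ S : Finset V, S ⊆ Δ → S.Nonempty →
    (∀ a ∈ S, ∀ b ∈ Δ, b ∉ S → ⟪a, b⟫ = 0) → S = Δ
  theta_mem : θ ∈ Pos
  theta_highest : ∀ γ ∈ Δ, θ - γ ∈ AddSubmonoid.closure (base : Set V)

namespace RootSystemCtx

variable {V : Type*} [NormedAddCommGroup V] [InnerProductSpace ℝ V]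

variable (ctx : RootSystemCtx V)

/-- The root order `γ ≼ γ'` on roots: `γ' - γ` is a nonnegative integral combination of
simple roots. -/
def rootLE (γ γ' : V) : Prop := γ' - γ ∈ AddSubmonoid.closure (ctx.base : Set V)

/-- `β` is the highest root of the root subsystem `S` (with respect to the ambient positive
system). -/
def IsHighest (S : Finset V) (β : V) : Prop :=
  β ∈ S ∧ β ∈ ctx.Pos ∧ ∀ γ ∈ S, ctx.rootLE γ β

/-- `CascadeMem ctx S β` : the pair (root subsystem `S = Δ⟨i⟩`, its highest root `β = βᵢ`)
occurs in the recursive construction of the Kostant cascade: one starts with `(Δ, θ)`, and the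
descendants of `(S, β)` are the pairs `(C, β')` where `C` is an irreducible component of
`{γ ∈ S | (γ, β) = 0}` and `β'` is the highest root of `C`. -/
inductive CascadeMem : Finset V → V → Prop
  | top : CascadeMem ctx.Δ ctx.θ
  | step {S C : Finset V} {β β' : V} : CascadeMem S β →
      IsComponent (orthSub S β) C → ctx.IsHighest C β' → CascadeMem C β'

/-- `K` is the Kostant cascade of the root system. -/
def IsCascade (K : Finset V) : Prop := ∀ β, β ∈ K ↔ ∃ S, ctx.CascadeMem S β

/-- The Heisenberg subset `H_β = {γ ∈ S ∩ Δ⁺ : (γ, β) > 0}` attached to a cascade pair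
`(S, β)`. -/
noncomputable def heis (S : Finset V) (β : V) : Finset V :=
  S.filter fun γ => γ ∈ ctx.Pos ∧ 0 < ⟪γ, β⟫

/-- A root is long if it has the same length as the highest root. -/
def IsLong (γ : V) : Prop := ⟪γ, γ⟫ = ⟪ctx.θ, ctx.θ⟫

/-- The highest root `θ` is a fundamental weight. -/
def ThetaFundamental : Prop :=
  ∃ α ∈ ctx.base, cartanPairing ctx.θ α = 1 ∧
    ∀ β ∈ ctx.base, β ≠ α → cartanPairing ctx.θ β = 0

/-- `β'` is a descendant of the cascade element `β`. -/
def Desc (β β' : V) : Prop :=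
  ∃ S C, ctx.CascadeMem S β ∧ IsComponent (orthSub S β) C ∧ ctx.IsHighest C β'

/-- The cascade poset order: `β ≤ β'` iff `β` is an iterated descendant of `β'`. -/
def cascLE (β β' : V) : Prop := Relation.ReflTransGen (fun a b => ctx.Desc b a) β β'

/-- A simple reflection of the root system. -/
def IsSimpleReflection (w : V ≃ₗ[ℝ] V) : Prop :=
  ∃ α ∈ ctx.base, ∀ v, w v = v - (2 * ⟪v, α⟫ / ⟪α, α⟫) • α

/-- The Weyl group, generated by the simple reflections. -/
def weylGroup : Subgroup (V ≃ₗ[ℝ] V) := Subgroup.closure {w | ctx.IsSimpleReflection w}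

/-- The length of a Weyl group element: the minimal number of simple reflections needed to
express it. -/
noncomputable def length (w : V ≃ₗ[ℝ] V) : ℕ :=
  sInf {n | ∃ l : List (V ≃ₗ[ℝ] V), l.length = n ∧
    (∀ s ∈ l, ctx.IsSimpleReflection s) ∧ l.prod = w}

/-- The root system is of type `Aₙ` (Cartan matrix characterisation). -/
def IsTypeA (n : ℕ) : Prop :=
  1 ≤ n ∧ ∃ e : Fin n ≃ {x // x ∈ ctx.base}, ∀ i j : Fin n,
    cartanPairing (e i : V) (e j : V) =
      (if i = j then 2 else if i.val + 1 = j.val ∨ j.val + 1 = i.val then -1 else 0)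

/-- The root system is of type `Bₙ` (`n ≥ 2`), with the last simple root short. -/
def IsTypeB (n : ℕ) : Prop :=
  2 ≤ n ∧ ∃ e : Fin n ≃ {x // x ∈ ctx.base}, ∀ i j : Fin n,
    cartanPairing (e i : V) (e j : V) =
      (if i = j then 2
       else if i.val + 2 = n ∧ j.val + 1 = n then -2
       else if i.val + 1 = j.val ∨ j.val + 1 = i.val then -1 else 0)

/-- The root system is of type `Cₙ` (`n ≥ 2`), with the last simple root long. -/
def IsTypeC (n : ℕ) : Prop :=
  2 ≤ n ∧ ∃ e : Fin n ≃ {x // x ∈ ctx.base}, ∀ i j : Fin n,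
    cartanPairing (e i : V) (e j : V) =
      (if i = j then 2
       else if i.val + 1 = n ∧ j.val + 2 = n then -2
       else if i.val + 1 = j.val ∨ j.val + 1 = i.val then -1 else 0)

/-- The root system is of type `G₂` (first simple root short). -/
def IsTypeG2 : Prop :=
  ∃ e : Fin 2 ≃ {x // x ∈ ctx.base},
    cartanPairing (e 0 : V) (e 0 : V) = 2 ∧ cartanPairing (e 1 : V) (e 1 : V) = 2 ∧
    cartanPairing (e 0 : V) (e 1 : V) = -1 ∧ cartanPairing (e 1 : V) (e 0 : V) = -3

/-- The set of roots `Δ(a_z) = w(Δ⁺_z(-1)) ∪ w(-Δ⁺_z(2))` of the abelian ideal attached by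
Kostant's construction to `z` (with `w = w_z`). -/
def idealSet (w : V ≃ₗ[ℝ] V) (x : V) : Set V :=
  {δ | ∃ γ ∈ ctx.Pos, (⟪γ, x⟫ = -1 ∧ δ = w γ) ∨ (⟪γ, x⟫ = 2 ∧ δ = -(w γ))}

end RootSystemCtx

section Components

variable {V : Type*} [NormedAddCommGroup V] [InnerProductSpace ℝ V]

lemma IsComponent.subset {T C : Finset V} (h : IsComponent T C) : C ⊆ T := by
  obtain ⟨γ, -, rfl⟩ := h
  exact Finset.filter_subset _ _

lemma connRel_symm (T : Finset V) : Std.Symm (connRel T) :=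
  ⟨fun _ _ h => ⟨h.2.1, h.1, by rw [real_inner_comm]; exact h.2.2⟩⟩

/-- A component absorbs every element of the subsystem that is not orthogonal to it. -/
lemma IsComponent.mem_of_inner_ne_zero {T C : Finset V} (h : IsComponent T C) {a b : V}
    (ha : a ∈ C) (hb : b ∈ T) (hab : ⟪a, b⟫ ≠ 0) : b ∈ C := by
  obtain ⟨γ, -, rfl⟩ := h
  obtain ⟨haT, hγa⟩ := Finset.mem_filter.1 ha
  exact Finset.mem_filter.2 ⟨hb, hγa.tail ⟨haT, hb, hab⟩⟩

lemma IsComponent.eq_of_inner_ne_zero {T C D : Finset V} (hC : IsComponent T C)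
    (hD : IsComponent T D) {a b : V} (ha : a ∈ C) (hb : b ∈ D) (hab : ⟪a, b⟫ ≠ 0) : C = D := by
  have := connRel_symm T
  obtain ⟨γ, -, rfl⟩ := hC
  obtain ⟨δ, -, rfl⟩ := hD
  obtain ⟨haT, hγa⟩ := Finset.mem_filter.1 ha
  obtain ⟨hbT, hδb⟩ := Finset.mem_filter.1 hb
  have hγδ : Relation.ReflTransGen (connRel T) γ δ :=
    (hγa.tail ⟨haT, hbT, hab⟩).trans (Std.Symm.symm _ _ hδb)
  have hδγ : Relation.ReflTransGen (connRel T) δ γ := Std.Symm.symm _ _ hγδ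
  exact Finset.filter_congr fun x _ => ⟨hδγ.trans, hγδ.trans⟩

end Components

namespace RootSystemCtx

variable {V : Type*} [NormedAddCommGroup V] [InnerProductSpace ℝ V] (ctx : RootSystemCtx V)

/-- The family `coeff` gives the coordinates of every root in the base. -/
def IsCoord (coeff : V → V → ℝ) : Prop := ∀ γ ∈ ctx.Δ, γ = ∑ α ∈ ctx.base, coeff γ α • α

/-- `S` is the standard Levi subsystem of all roots supported on `I`. -/
def IsLevi (coeff : V → V → ℝ) (S I : Finset V) : Prop :=
  I ⊆ ctx.base ∧ ∀ γ, γ ∈ S ↔ γ ∈ ctx.Δ ∧ ∀ α ∈ ctx.base, α ∉ I → coeff γ α = 0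

/-- The pair `p` is a child of the cascade pair `q`. -/
def CascadeStep (p q : Finset V × V) : Prop :=
  ctx.CascadeMem q.1 q.2 ∧ IsComponent (orthSub q.1 q.2) p.1 ∧ ctx.IsHighest p.1 p.2

variable {ctx}

lemma inner_self_ne_zero_of_mem {γ : V} (h : γ ∈ ctx.Δ) : ⟪γ, γ⟫ ≠ 0 := by
  rw [inner_self_ne_zero]
  rintro rfl
  exact ctx.zero_not_mem h

lemma mem_of_base {α : V} (h : α ∈ ctx.base) : α ∈ ctx.Δ := ctx.pos_subset (ctx.base_subset h)

lemma coords_unique {a b : V → ℝ} (h : ∑ α ∈ ctx.base, a α • α = ∑ α ∈ ctx.base, b α • α) :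
    ∀ α ∈ ctx.base, a α = b α := by
  have hli := linearIndependent_iff'.1 ctx.base_indep Finset.univ (fun x => a x - b x) (by
    rw [Finset.univ_eq_attach, Finset.sum_attach ctx.base (fun x => (a x - b x) • x)]
    simp [sub_smul, h])
  intro α hα
  exact sub_eq_zero.1 (hli ⟨α, hα⟩ (Finset.mem_univ _))

lemma exists_coords_of_mem_closure {x : V} (h : x ∈ AddSubmonoid.closure (ctx.base : Set V)) :
    ∃ n : V → ℝ, (∀ α, 0 ≤ n α) ∧ x = ∑ α ∈ ctx.base, n α • α := by
  induction h using AddSubmonoid.closure_induction with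
  | mem x hx =>
    refine ⟨fun α => if α = x then 1 else 0, fun α => by dsimp only; split_ifs <;> norm_num, ?_⟩
    have hx' : x ∈ ctx.base := hx
    simp [ite_smul, hx']
  | zero => exact ⟨fun _ => 0, fun _ => le_rfl, by simp⟩
  | add x y _ _ hx hy =>
    obtain ⟨n, hn, rfl⟩ := hx
    obtain ⟨m, hm, rfl⟩ := hy
    exact ⟨fun α => n α + m α, fun α => add_nonneg (hn α) (hm α),
      by simp [add_smul, Finset.sum_add_distrib]⟩

lemma rootLE_trans {a b c : V} (h : ctx.rootLE a b) (h' : ctx.rootLE b c) : ctx.rootLE a c := by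
  have := add_mem h' h
  rwa [sub_add_sub_cancel] at this

lemma rootLE_antisymm {a b : V} (h : ctx.rootLE a b) (h' : ctx.rootLE b a) : a = b := by
  obtain ⟨n, hn, hn'⟩ := exists_coords_of_mem_closure h
  obtain ⟨m, hm, hm'⟩ := exists_coords_of_mem_closure h'
  have hsum : ∑ α ∈ ctx.base, (n α + m α) • α = ∑ α ∈ ctx.base, (0 : ℝ) • α := by
    simp only [add_smul, Finset.sum_add_distrib, ← hn', ← hm']
    simp
  have h0 : b - a = 0 := by
    rw [hn']
    refine Finset.sum_eq_zero fun α hα => ?_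
    have := coords_unique hsum α hα
    rw [show n α = 0 by linarith [hn α, hm α], zero_smul]
  exact (sub_eq_zero.1 h0).symm

variable {coeff : V → V → ℝ}

lemma IsCoord.eq_of_eq_sum (hc : ctx.IsCoord coeff) {γ : V} (hγ : γ ∈ ctx.Δ) {a : V → ℝ}
    (h : γ = ∑ α ∈ ctx.base, a α • α) {α : V} (hα : α ∈ ctx.base) : coeff γ α = a α :=
  coords_unique ((hc γ hγ).symm.trans h) α hα

lemma IsCoord.coeff_nonneg (hc : ctx.IsCoord coeff) {γ : V} (hγ : γ ∈ ctx.Pos) {α : V}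
    (hα : α ∈ ctx.base) : 0 ≤ coeff γ α := by
  obtain ⟨n, hn, h⟩ := exists_coords_of_mem_closure (ctx.pos_coords γ hγ)
  rw [hc.eq_of_eq_sum (ctx.pos_subset hγ) h hα]
  exact hn α

lemma IsCoord.coeff_neg (hc : ctx.IsCoord coeff) {γ : V} (hγ : γ ∈ ctx.Δ) {α : V}
    (hα : α ∈ ctx.base) : coeff (-γ) α = -coeff γ α :=
  hc.eq_of_eq_sum (a := fun α => -coeff γ α) (ctx.neg_mem γ hγ)
    (by simp only [neg_smul, Finset.sum_neg_distrib, ← hc γ hγ]) hα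

lemma IsCoord.coeff_mono (hc : ctx.IsCoord coeff) {γ δ : V} (hγ : γ ∈ ctx.Δ) (hδ : δ ∈ ctx.Δ)
    (h : ctx.rootLE γ δ) {α : V} (hα : α ∈ ctx.base) : coeff γ α ≤ coeff δ α := by
  obtain ⟨n, hn, h⟩ := exists_coords_of_mem_closure h
  have : coeff δ α = coeff γ α + n α :=
    hc.eq_of_eq_sum (a := fun α => coeff γ α + n α) hδ
      (by simp only [add_smul, Finset.sum_add_distrib, ← hc γ hγ, ← h]; abel) hα
  linarith [hn α]

lemma IsCoord.coeff_sub_smul (hc : ctx.IsCoord coeff) {γ α : V} {k : ℝ} (hγ : γ ∈ ctx.Δ)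
    (hα : α ∈ ctx.base) (h : γ - k • α ∈ ctx.Δ) {α' : V} (hα' : α' ∈ ctx.base) :
    coeff (γ - k • α) α' = coeff γ α' - if α' = α then k else 0 :=
  hc.eq_of_eq_sum (a := fun α' => coeff γ α' - if α' = α then k else 0) h
    (by simp [sub_smul, ite_smul, Finset.sum_sub_distrib, ← hc γ hγ, hα]) hα'

lemma IsCoord.coeff_base (hc : ctx.IsCoord coeff) {α α' : V} (hα : α ∈ ctx.base)
    (hα' : α' ∈ ctx.base) : coeff α α' = if α' = α then 1 else 0 :=
  hc.eq_of_eq_sum (a := fun α' => if α' = α then 1 else 0) (mem_of_base hα)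
    (by simp [ite_smul, hα]) hα'

lemma IsCoord.inner_eq (hc : ctx.IsCoord coeff) {γ : V} (hγ : γ ∈ ctx.Δ) (v : V) :
    ⟪γ, v⟫ = ∑ α ∈ ctx.base, coeff γ α * ⟪α, v⟫ := by
  conv_lhs => rw [hc γ hγ]
  simp [sum_inner, real_inner_smul_left]

lemma IsCoord.exists_coeff_ne_zero (hc : ctx.IsCoord coeff) {γ : V} (hγ : γ ∈ ctx.Δ) (v : V)
    (h : ⟪γ, v⟫ ≠ 0) : ∃ α ∈ ctx.base, coeff γ α ≠ 0 ∧ ⟪α, v⟫ ≠ 0 := by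
  rw [hc.inner_eq hγ] at h
  obtain ⟨α, hα, h⟩ := Finset.exists_ne_zero_of_sum_ne_zero h
  exact ⟨α, hα, left_ne_zero_of_mul h, right_ne_zero_of_mul h⟩

lemma IsCoord.inner_base_nonpos (hc : ctx.IsCoord coeff) {α α' : V} (hα : α ∈ ctx.base)
    (hα' : α' ∈ ctx.base) (hne : α' ≠ α) : ⟪α', α⟫ ≤ 0 := by
  have hmem := ctx.reflect_mem α (mem_of_base hα) α' (mem_of_base hα')
  have h1 := hc.coeff_sub_smul (mem_of_base hα') hα hmem hα
  have h2 := hc.coeff_sub_smul (mem_of_base hα') hα hmem hα'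
  rw [hc.coeff_base hα' hα, if_neg hne.symm, if_pos rfl] at h1
  rw [hc.coeff_base hα' hα', if_neg hne, if_pos rfl] at h2
  have hk : cartanPairing α' α ≤ 0 := by
    rcases ctx.pos_or_neg _ hmem with h | h
    · linarith [hc.coeff_nonneg h hα]
    · have := hc.coeff_nonneg h hα'
      rw [hc.coeff_neg hmem hα'] at this
      linarith
  have hpos : 0 < ⟪α, α⟫ :=
    lt_of_le_of_ne real_inner_self_nonneg (inner_self_ne_zero_of_mem (mem_of_base hα)).symm
  rw [cartanPairing, div_le_iff₀ hpos] at hk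
  linarith

lemma IsLevi.mem_iff_base (hc : ctx.IsCoord coeff) {S I : Finset V} (h : ctx.IsLevi coeff S I)
    {α : V} (hα : α ∈ ctx.base) : α ∈ S ↔ α ∈ I := by
  rw [h.2]
  constructor
  · rintro ⟨-, hS⟩
    by_contra hI
    simpa [hc.coeff_base hα hα] using hS α hα hI
  · intro hI
    refine ⟨mem_of_base hα, fun α' hα' hI' => ?_⟩
    rw [hc.coeff_base hα hα', if_neg]
    rintro rfl
    exact hI' hI

/-- The highest root of a Levi subsystem is dominant for that subsystem. -/
lemma IsLevi.inner_nonneg (hc : ctx.IsCoord coeff) {S I : Finset V} (h : ctx.IsLevi coeff S I)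
    {β α : V} (hβ : ctx.IsHighest S β) (hα : α ∈ I) : 0 ≤ ⟪α, β⟫ := by
  have hαb := h.1 hα
  obtain ⟨hβΔ, hβI⟩ := (h.2 β).1 hβ.1
  have hmem := ctx.reflect_mem α (mem_of_base hαb) β hβΔ
  have hS : β - cartanPairing β α • α ∈ S := by
    refine (h.2 _).2 ⟨hmem, fun α' hα' hI' => ?_⟩
    rw [hc.coeff_sub_smul hβΔ hαb hmem hα', hβI α' hα' hI', if_neg, sub_zero]
    rintro rfl
    exact hI' hα
  have hle := hc.coeff_mono hmem hβΔ (hβ.2.2 _ hS) hαb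
  rw [hc.coeff_sub_smul hβΔ hαb hmem hαb, if_pos rfl] at hle
  have hpos : 0 < ⟪α, α⟫ :=
    lt_of_le_of_ne real_inner_self_nonneg (inner_self_ne_zero_of_mem (mem_of_base hαb)).symm
  have hk : 0 ≤ cartanPairing β α := by linarith
  rw [cartanPairing, le_div_iff₀ hpos, real_inner_comm α β] at hk
  linarith

/-- A simple root that pairs positively with a positive root of a Levi subsystem lies in it. -/
lemma IsLevi.mem_of_inner_pos (hc : ctx.IsCoord coeff) {S I : Finset V}
    (h : ctx.IsLevi coeff S I) {β α : V} (hβ : β ∈ S) (hβ' : β ∈ ctx.Pos) (hα : α ∈ ctx.base)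
    (hpos : 0 < ⟪α, β⟫) : α ∈ S := by
  rw [h.mem_iff_base hc hα]
  by_contra hI
  obtain ⟨hβΔ, hβI⟩ := (h.2 β).1 hβ
  rw [real_inner_comm, hc.inner_eq hβΔ] at hpos
  refine absurd hpos (not_lt.2 (Finset.sum_nonpos fun α' hα' => ?_))
  by_cases hne : α' = α
  · rw [hne, hβI α hα hI, zero_mul]
  · exact mul_nonpos_of_nonneg_of_nonpos (hc.coeff_nonneg hβ' hα')
      (hc.inner_base_nonpos hα hα' hne)

/-- If a positive root is orthogonal to a vector dominant on its support, then so is every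
simple root in that support. -/
lemma IsCoord.inner_eq_zero_of_pos (hc : ctx.IsCoord coeff) {γ v : V} (hγ : γ ∈ ctx.Pos)
    (hv : ∀ α ∈ ctx.base, coeff γ α ≠ 0 → 0 ≤ ⟪α, v⟫) (h : ⟪γ, v⟫ = 0) {α : V}
    (hα : α ∈ ctx.base) (hne : coeff γ α ≠ 0) : ⟪α, v⟫ = 0 := by
  rw [hc.inner_eq (ctx.pos_subset hγ), Finset.sum_eq_zero_iff_of_nonneg] at h
  · exact (mul_eq_zero.1 (h α hα)).resolve_left hne
  · intro α' hα'
    by_cases h0 : coeff γ α' = 0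
    · rw [h0, zero_mul]
    · exact mul_nonneg (hc.coeff_nonneg hγ hα') (hv α' hα' h0)

lemma IsCoord.inner_eq_zero_of_root (hc : ctx.IsCoord coeff) {γ v : V} (hγ : γ ∈ ctx.Δ)
    (hv : ∀ α ∈ ctx.base, coeff γ α ≠ 0 → 0 ≤ ⟪α, v⟫) (h : ⟪γ, v⟫ = 0) {α : V}
    (hα : α ∈ ctx.base) (hne : coeff γ α ≠ 0) : ⟪α, v⟫ = 0 := by
  rcases ctx.pos_or_neg γ hγ with hp | hp
  · exact hc.inner_eq_zero_of_pos hp hv h hα hne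
  · refine hc.inner_eq_zero_of_pos hp (fun α' hα' h' => hv α' hα' ?_) (by simp [h]) hα ?_
    · rwa [hc.coeff_neg hγ hα', neg_ne_zero] at h'
    · rwa [hc.coeff_neg hγ hα, neg_ne_zero]

lemma IsLevi.orthSub (hc : ctx.IsCoord coeff) {S I : Finset V} (h : ctx.IsLevi coeff S I)
    {β : V} (hβ : ctx.IsHighest S β) :
    ctx.IsLevi coeff (orthSub S β) (I.filter fun α => ⟪α, β⟫ = 0) := by
  refine ⟨(Finset.filter_subset _ _).trans h.1, fun γ => ?_⟩
  rw [_root_.orthSub, Finset.mem_filter]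
  constructor
  · rintro ⟨hγS, hγβ⟩
    obtain ⟨hγΔ, hγI⟩ := (h.2 γ).1 hγS
    refine ⟨hγΔ, fun α hα hI => ?_⟩
    by_contra hne
    have hmem : ∀ α ∈ ctx.base, coeff γ α ≠ 0 → α ∈ I := fun α hα h' => by
      by_contra hI
      exact h' (hγI α hα hI)
    exact hI (Finset.mem_filter.2 ⟨hmem α hα hne, hc.inner_eq_zero_of_root hγΔ
      (fun α' hα' h' => h.inner_nonneg hc hβ (hmem α' hα' h')) hγβ hα hne⟩)
  · rintro ⟨hγΔ, hγI⟩
    refine ⟨(h.2 γ).2 ⟨hγΔ, fun α hα hI => hγI α hα fun h' => hI (Finset.mem_filter.1 h').1⟩, ?_⟩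
    by_contra hne
    obtain ⟨α, hα, h1, h2⟩ := hc.exists_coeff_ne_zero hγΔ β hne
    exact h1 (hγI α hα fun h' => h2 (Finset.mem_filter.1 h').2)

lemma IsLevi.component (hc : ctx.IsCoord coeff) {T I C : Finset V} (h : ctx.IsLevi coeff T I)
    (hC : IsComponent T C) : ctx.IsLevi coeff C (I.filter fun α => α ∈ C) := by
  refine ⟨(Finset.filter_subset _ _).trans h.1, fun δ => ?_⟩
  constructor
  · intro hδ
    obtain ⟨hδΔ, hδI⟩ := (h.2 δ).1 (hC.subset hδ)
    refine ⟨hδΔ, ?_⟩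
    have horth : ∀ α ∈ I, α ∉ C → ∀ γ ∈ C, ⟪γ, α⟫ = 0 := fun α hα hαC γ hγ => by
      by_contra hne
      exact hαC (hC.mem_of_inner_ne_zero hγ ((h.mem_iff_base hc (h.1 hα)).2 hα) hne)
    set a : V → ℝ := fun α => if α ∈ C then 0 else coeff δ α with ha
    have hzero : ∀ γ ∈ C, ⟪γ, ∑ α ∈ ctx.base, a α • α⟫ = 0 := fun γ hγ => by
      rw [inner_sum]
      refine Finset.sum_eq_zero fun α hα => ?_
      rw [real_inner_smul_right]
      by_cases hαC : α ∈ C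
      · simp [ha, hαC]
      · by_cases hαI : α ∈ I
        · rw [horth α hαI hαC γ hγ, mul_zero]
        · simp [ha, hδI α hα hαI]
    have hself : ∑ α ∈ ctx.base, a α • α = ∑ α ∈ ctx.base, (0 : ℝ) • α := by
      have hsplit : ∑ α ∈ ctx.base, a α • α =
          δ - ∑ α ∈ ctx.base, (if α ∈ C then coeff δ α else 0) • α := by
        rw [eq_sub_iff_add_eq, ← Finset.sum_add_distrib]
        conv_rhs => rw [hc δ hδΔ]
        refine Finset.sum_congr rfl fun α _ => ?_
        by_cases hαC : α ∈ C <;> simp [ha, hαC]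
      have : ⟪∑ α ∈ ctx.base, a α • α, ∑ α ∈ ctx.base, a α • α⟫ = 0 := by
        conv_lhs => lhs; rw [hsplit]
        rw [inner_sub_left, hzero δ hδ, sum_inner, zero_sub, neg_eq_zero]
        refine Finset.sum_eq_zero fun α _ => ?_
        rw [real_inner_smul_left]
        by_cases hαC : α ∈ C
        · rw [hzero α hαC, mul_zero]
        · simp [hαC]
      rw [inner_self_eq_zero.1 this]
      simp
    intro α hα hαI
    by_cases hαC : α ∈ C
    · exact hδI α hα fun h' => hαI (Finset.mem_filter.2 ⟨h', hαC⟩)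
    · simpa [ha, hαC] using coords_unique hself α hα
  · rintro ⟨hδΔ, hδI⟩
    have hδT : δ ∈ T :=
      (h.2 δ).2 ⟨hδΔ, fun α hα hI => hδI α hα fun h' => hI (Finset.mem_filter.1 h').1⟩
    obtain ⟨α, hα, h1, h2⟩ := hc.exists_coeff_ne_zero hδΔ δ (inner_self_ne_zero_of_mem hδΔ)
    have hαC : α ∈ C := by
      by_contra hαC
      exact h1 (hδI α hα fun h' => hαC (Finset.mem_filter.1 h').2)
    exact hC.mem_of_inner_ne_zero hαC hδT h2

lemma CascadeMem.isHighest {S : Finset V} {β : V} (h : ctx.CascadeMem S β) :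
    ctx.IsHighest S β := by
  cases h with
  | top => exact ⟨ctx.pos_subset ctx.theta_mem, ctx.theta_mem, ctx.theta_highest⟩
  | step _ _ h => exact h

/-- Every root subsystem occurring in the cascade is a standard Levi subsystem. -/
lemma CascadeMem.exists_isLevi (hc : ctx.IsCoord coeff) {S : Finset V} {β : V}
    (h : ctx.CascadeMem S β) : ∃ I, ctx.IsLevi coeff S I := by
  induction h with
  | top => exact ⟨ctx.base, subset_rfl, fun γ => ⟨fun h => ⟨h, fun _ h h' => absurd h h'⟩,
      fun h => h.1⟩⟩
  | step hS hC _ ih =>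
    obtain ⟨I, hI⟩ := ih
    exact ⟨_, (hI.orthSub hc hS.isHighest).component hc hC⟩

lemma IsHighest.unique {S : Finset V} {β β' : V} (h : ctx.IsHighest S β)
    (h' : ctx.IsHighest S β') : β = β' :=
  rootLE_antisymm (h'.2.2 _ h.1) (h.2.2 _ h'.1)

lemma IsHighest.inner_self_ne_zero {S : Finset V} {β : V} (h : ctx.IsHighest S β) :
    ⟪β, β⟫ ≠ 0 := inner_self_ne_zero_of_mem (ctx.pos_subset h.2.1)

lemma CascadeStep.subset_orthSub {p q : Finset V × V} (h : ctx.CascadeStep p q) :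
    p.1 ⊆ orthSub q.1 q.2 := h.2.1.subset

lemma CascadeStep.subset {p q : Finset V × V} (h : ctx.CascadeStep p q) : p.1 ⊆ q.1 :=
  h.subset_orthSub.trans (Finset.filter_subset _ _)

lemma subset_of_reflTransGen {p q : Finset V × V}
    (h : Relation.ReflTransGen ctx.CascadeStep p q) : p.1 ⊆ q.1 := by
  induction h with
  | refl => exact subset_rfl
  | tail _ h ih => exact ih.trans h.subset

lemma cascLE_of_reflTransGen {p q : Finset V × V}
    (h : Relation.ReflTransGen ctx.CascadeStep p q) : ctx.cascLE p.2 q.2 :=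
  Relation.ReflTransGen.lift Prod.snd (fun a b hab => ⟨b.1, a.1, hab⟩) _ _ h

lemma CascadeMem.reflTransGen_top {S : Finset V} {β : V} (h : ctx.CascadeMem S β) :
    Relation.ReflTransGen ctx.CascadeStep (S, β) (ctx.Δ, ctx.θ) := by
  induction h with
  | top => exact .refl
  | step hS hC hH ih => exact .head ⟨hS, hC, hH⟩ ih

/-- Two cascade pairs are comparable or have orthogonal root subsystems. -/
lemma CascadeMem.trichotomy {S T : Finset V} {β δ : V} (hS : ctx.CascadeMem S β)
    (hT : ctx.CascadeMem T δ) :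
    Relation.ReflTransGen ctx.CascadeStep (S, β) (T, δ) ∨
      Relation.ReflTransGen ctx.CascadeStep (T, δ) (S, β) ∨ ∀ a ∈ S, ∀ b ∈ T, ⟪a, b⟫ = 0 := by
  induction hS with
  | top => exact .inr (.inl hT.reflTransGen_top)
  | @step S C β β' hS hC hH ih =>
    have hstep : ctx.CascadeStep (C, β') (S, β) := ⟨hS, hC, hH⟩
    rcases ih with h | h | h
    · exact .inl (.head hstep h)
    · rcases Relation.ReflTransGen.cases_tail h with h | ⟨⟨Q, c⟩, hQ, hQS⟩
      · rw [← h]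
        exact .inl (.single (h ▸ hstep))
      · by_cases horth : ∀ a ∈ C, ∀ b ∈ Q, ⟪a, b⟫ = 0
        · exact .inr (.inr fun a ha b hb => horth a ha b (subset_of_reflTransGen hQ hb))
        · push Not at horth
          obtain ⟨a, ha, b, hb, hab⟩ := horth
          obtain rfl : C = Q := hC.eq_of_inner_ne_zero hQS.2.1 ha hb hab
          obtain rfl : β' = c := hH.unique hQS.2.2
          exact .inr (.inl hQ)
    · exact .inr (.inr fun a ha => h a (hstep.subset ha))

lemma eq_of_reflTransGen {S T : Finset V} {β : V} (hS : ctx.IsHighest S β)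
    (h : Relation.ReflTransGen ctx.CascadeStep (S, β) (T, β)) : S = T := by
  rcases Relation.ReflTransGen.cases_tail h with h | ⟨q, hq, hqT⟩
  · exact (congrArg Prod.fst h).symm
  · exact absurd (Finset.mem_filter.1 (hqT.subset_orthSub (subset_of_reflTransGen hq hS.1))).2
      hS.inner_self_ne_zero

/-- A cascade root determines its root subsystem. -/
lemma CascadeMem.subsystem_unique {S T : Finset V} {β : V} (hS : ctx.CascadeMem S β)
    (hT : ctx.CascadeMem T β) : S = T := by
  rcases hS.trichotomy hT with h | h | h
  · exact eq_of_reflTransGen hS.isHighest h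
  · exact (eq_of_reflTransGen hT.isHighest h).symm
  · exact absurd (h β hS.isHighest.1 β hT.isHighest.1) hS.isHighest.inner_self_ne_zero

lemma eq_of_reflTransGen_of_common_child {S T C : Finset V} {β δ ν : V}
    (hβ : ctx.CascadeStep (C, ν) (S, β)) (hδ : ctx.CascadeStep (C, ν) (T, δ))
    (h : Relation.ReflTransGen ctx.CascadeStep (S, β) (T, δ)) : β = δ := by
  rcases Relation.ReflTransGen.cases_tail h with h | ⟨⟨Q, c⟩, hQ, hQT⟩
  · exact (congrArg Prod.snd h).symm
  · have hSQ : S ⊆ Q := subset_of_reflTransGen hQ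
    have hCQ : C = Q := hδ.2.1.eq_of_inner_ne_zero hQT.2.1 hβ.2.2.1 (hSQ (hβ.subset hβ.2.2.1))
      hβ.2.2.inner_self_ne_zero
    have hβH := hβ.1.isHighest
    have hβC : β ∈ C := hCQ ▸ hSQ hβH.1
    exact absurd (Finset.mem_filter.1 (hβ.subset_orthSub hβC)).2 hβH.inner_self_ne_zero

/-- A cascade element has at most one parent. -/
lemma Desc.parent_unique {β δ ν : V} (hβ : ctx.Desc β ν) (hδ : ctx.Desc δ ν) : β = δ := by
  obtain ⟨S, C, hS, hC, hν⟩ := hβ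
  obtain ⟨T, D, hT, hD, hν'⟩ := hδ
  obtain rfl : C = D := (hS.step hC hν).subsystem_unique (hT.step hD hν')
  have h1 : ctx.CascadeStep (C, ν) (S, β) := ⟨hS, hC, hν⟩
  have h2 : ctx.CascadeStep (C, ν) (T, δ) := ⟨hT, hD, hν'⟩
  rcases hS.trichotomy hT with h | h | h
  · exact eq_of_reflTransGen_of_common_child h1 h2 h
  · exact (eq_of_reflTransGen_of_common_child h2 h1 h).symm
  · exact absurd (h ν (h1.subset hν.1) ν (h2.subset hν.1)) hν.inner_self_ne_zero

lemma Desc.rootLE {β β' : V} (h : ctx.Desc β β') : ctx.rootLE β' β := by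
  obtain ⟨S, C, hS, hC, hβ'⟩ := h
  exact hS.isHighest.2.2 _ (CascadeStep.subset (p := (C, β')) (q := (S, β)) ⟨hS, hC, hβ'⟩ hβ'.1)

lemma cascLE.rootLE {β β' : V} (h : ctx.cascLE β β') : ctx.rootLE β β' := by
  induction h with
  | refl => simp [RootSystemCtx.rootLE]
  | tail _ h ih => exact rootLE_trans ih h.rootLE

lemma Desc.exists_coeff_eq_zero (hc : ctx.IsCoord coeff) {β β' : V} (h : ctx.Desc β β') :
    ∃ α ∈ ctx.base, coeff β α ≠ 0 ∧ coeff β' α = 0 := by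
  obtain ⟨S, C, hS, hC, hβ'⟩ := h
  obtain ⟨I, hI⟩ := hS.exists_isLevi hc
  have hβ := hS.isHighest
  obtain ⟨hβ'S, horth⟩ := Finset.mem_filter.1 (hC.subset hβ'.1)
  obtain ⟨α, hα, h1, h2⟩ := hc.exists_coeff_ne_zero (ctx.pos_subset hβ.2.1) β hβ.inner_self_ne_zero
  refine ⟨α, hα, h1, ?_⟩
  by_contra hne
  refine h2 (hc.inner_eq_zero_of_pos hβ'.2.1 (fun α' hα' h' => hI.inner_nonneg hc hβ ?_)
    horth hα hne)
  by_contra hαI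
  exact h' (((hI.2 _).1 hβ'S).2 α' hα' hαI)

/-- Cascade roots whose supports meet are comparable. -/
lemma CascadeMem.comparable (hc : ctx.IsCoord coeff) {S T : Finset V} {β δ : V}
    (hS : ctx.CascadeMem S β) (hT : ctx.CascadeMem T δ) {α : V} (hα : α ∈ ctx.base)
    (hβ : coeff β α ≠ 0) (hδ : coeff δ α ≠ 0) : ctx.cascLE β δ ∨ ctx.cascLE δ β := by
  rcases hS.trichotomy hT with h | h | h
  · exact .inl (cascLE_of_reflTransGen h)
  · exact .inr (cascLE_of_reflTransGen h)
  · have hmem : ∀ {S : Finset V} {β : V}, ctx.CascadeMem S β → coeff β α ≠ 0 → α ∈ S := by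
      intro S β hS hβ
      obtain ⟨I, hI⟩ := hS.exists_isLevi hc
      rw [hI.mem_iff_base hc hα]
      by_contra hαI
      exact hβ (((hI.2 _).1 hS.isHighest.1).2 α hα hαI)
    exact absurd (h α (hmem hS hβ) α (hmem hT hδ)) (inner_self_ne_zero_of_mem (mem_of_base hα))

end RootSystemCtx

/-- Properties of the marked cascade poset `(K, ≼, Φ)` of a simple Lie algebra. -/
theorem mcp_properties {V : Type*} [NormedAddCommGroup V] [InnerProductSpace ℝ V]
    [FiniteDimensional ℝ V] (ctx : RootSystemCtx V)
    (K : Finset V) (hK : ctx.IsCascade K)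
    (Sub : V → Finset V) (hSub : ∀ β ∈ K, ctx.CascadeMem (Sub β) β)
    (coeff : V → V → ℝ) (hcoeff : ∀ γ ∈ ctx.Δ, γ = ∑ α ∈ ctx.base, coeff γ α • α)
    (supp : V → Set V) (hsupp : ∀ γ, supp γ = {α | α ∈ ctx.base ∧ coeff γ α ≠ 0}) :
    -- (1) the cascade poset order coincides with the restriction to K of the root order
    (∀ β ∈ K, ∀ β' ∈ K, (ctx.cascLE β β' ↔ ctx.rootLE β β')) ∧
    -- (2) two cascade elements are comparable iff their supports intersect, and then one
    -- support is properly contained in the other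
    (∀ β ∈ K, ∀ β' ∈ K,
      ((ctx.cascLE β β' ∨ ctx.cascLE β' β) ↔ (supp β ∩ supp β').Nonempty) ∧
      (ctx.cascLE β β' → β ≠ β' → supp β ⊂ supp β')) ∧
    -- (3) each cascade element other than θ is covered by a unique element of K
    (∀ β' ∈ K, β' ≠ ctx.θ → ∃! β, β ∈ K ∧ ctx.Desc β β') ∧
    -- (4) each interval [β, θ] in the cascade poset is a chain
    (∀ β ∈ K, IsChain ctx.cascLE {ν | ν ∈ K ∧ ctx.cascLE β ν ∧ ctx.cascLE ν ctx.θ}) ∧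
    -- (5) for a simple root α, α ∈ Φ(β) iff (α, β) > 0
    (∀ β ∈ K, ∀ α ∈ ctx.base, (α ∈ ctx.heis (Sub β) β ↔ 0 < ⟪α, β⟫)) := by
  have hc : ctx.IsCoord coeff := hcoeff
  have hPos : ∀ β ∈ K, β ∈ ctx.Pos := fun β hβ => (hSub β hβ).isHighest.2.1
  have hΔ : ∀ β ∈ K, β ∈ ctx.Δ := fun β hβ => ctx.pos_subset (hPos β hβ)
  have hmem : ∀ γ α, α ∈ supp γ ↔ α ∈ ctx.base ∧ coeff γ α ≠ 0 := fun γ α => by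
    rw [hsupp]; rfl
  have hmono : ∀ β ∈ K, ∀ β' ∈ K, ctx.rootLE β β' → supp β ⊆ supp β' := by
    intro β hβ β' hβ' hle α hα
    rw [hmem] at hα ⊢
    have h1 := hc.coeff_mono (hΔ β hβ) (hΔ β' hβ') hle hα.1
    have h2 := hc.coeff_nonneg (hPos β hβ) hα.1
    exact ⟨hα.1, ((lt_of_le_of_ne h2 hα.2.symm).trans_le h1).ne'⟩
  have hne : ∀ β ∈ K, (supp β).Nonempty := by
    intro β hβ
    obtain ⟨α, hα, h, -⟩ := hc.exists_coeff_ne_zero (hΔ β hβ) β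
      (RootSystemCtx.inner_self_ne_zero_of_mem (hΔ β hβ))
    exact ⟨α, (hmem β α).2 ⟨hα, h⟩⟩
  have hcomp : ∀ β ∈ K, ∀ β' ∈ K, (supp β ∩ supp β').Nonempty →
      ctx.cascLE β β' ∨ ctx.cascLE β' β := by
    rintro β hβ β' hβ' ⟨α, h, h'⟩
    rw [hmem] at h h'
    exact (hSub β hβ).comparable hc (hSub β' hβ') h.1 h.2 h'.2
  have hinter : ∀ ν ∈ K, ∀ β ∈ K, ∀ β' ∈ K, ctx.rootLE ν β → ctx.rootLE ν β' →
      (supp β ∩ supp β').Nonempty := fun ν hν β hβ β' hβ' h h' =>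
    (hne ν hν).mono (Set.subset_inter (hmono ν hν β hβ h) (hmono ν hν β' hβ' h'))
  have hrefl : ∀ β, ctx.rootLE β β := fun β =>
    RootSystemCtx.cascLE.rootLE (ctx := ctx) Relation.ReflTransGen.refl
  refine ⟨fun β hβ β' hβ' => ⟨fun h => h.rootLE, fun h => ?_⟩,
    fun β hβ β' hβ' => ⟨⟨?_, hcomp β hβ β' hβ'⟩, ?_⟩, ?_, ?_, ?_⟩
  · rcases hcomp β hβ β' hβ' (hinter β hβ β hβ β' hβ' (hrefl β) h) with h' | h'
    · exact h'
    · rw [RootSystemCtx.rootLE_antisymm h h'.rootLE]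
      exact Relation.ReflTransGen.refl
  · rintro (h | h)
    · exact hinter β hβ β hβ β' hβ' (hrefl β) h.rootLE
    · exact hinter β' hβ' β hβ β' hβ' h.rootLE (hrefl β')
  · intro h hneq
    refine ⟨hmono β hβ β' hβ' h.rootLE, fun hsub => ?_⟩
    rcases Relation.ReflTransGen.cases_tail h with h' | ⟨c, hβc, hcβ'⟩
    · exact hneq h'.symm
    · have hcK : c ∈ K := by
        obtain ⟨S, C, hS, hC, hH⟩ := hcβ'
        exact (hK c).2 ⟨C, hS.step hC hH⟩
      obtain ⟨α, hα, h1, h2⟩ := hcβ'.exists_coeff_eq_zero hc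
      exact ((hmem c α).1 (hmono β hβ c hcK (RootSystemCtx.cascLE.rootLE hβc)
        (hsub ((hmem β' α).2 ⟨hα, h1⟩)))).2 h2
  · intro β' hβ' hθ
    have hmemβ' := hSub β' hβ'
    generalize Sub β' = S' at hmemβ'
    cases hmemβ' with
    | top => exact absurd rfl hθ
    | @step S C β _ hS hC hH =>
      have hdesc : ctx.Desc β β' := ⟨S, _, hS, hC, hH⟩
      exact ⟨β, ⟨(hK β).2 ⟨S, hS⟩, hdesc⟩, fun δ hδ => hδ.2.parent_unique hdesc⟩
  · rintro β hβ ν ⟨hν, hβν, -⟩ ν' ⟨hν', hβν', -⟩ -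
    exact hcomp ν hν ν' hν' (hinter β hβ ν hν ν' hν' hβν.rootLE hβν'.rootLE)
  · intro β hβ α hα
    rw [RootSystemCtx.heis, Finset.mem_filter]
    refine ⟨fun h => h.2.2, fun h => ⟨?_, ctx.base_subset hα, h⟩⟩
    obtain ⟨I, hI⟩ := (hSub β hβ).exists_isLevi hc
    exact hI.mem_of_inner_pos hc (hSub β hβ).isHighest.1 (hPos β hβ) hα h
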